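/- Let F = ℂ(λ, z) be the field of rational functions in two variables λ, z over ℂ, and let B = F[Y,W]/(z·W² + Y² + W + z³ − λ). Then there is no F-algebra isomorphism between B and the Laurent polynomial ring F[U, U⁻¹]. (The generic fiber of the fibration ξ₀ = (f, pr_z) : 𝔸³ → 𝔸², f(y,z,w) = w²z + y² + w + z³, is a NONTRIVIAL form of the punctured affine line over ℂ(λ, z) — the nontriviality assertion of Example 4.4.) -/

import Mathlib

open MvPolynomial

/-- `F = ℂ(λ, z)`, the field of rational functions in two variables over ℂ,
realized as the fraction field of `ℂ[λ][z]`. -/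
abbrev Ffield : Type := FractionRing (Polynomial (Polynomial ℂ))

/-- The rational function `λ` (the first variable). -/
noncomputable def lam : Ffield :=
  algebraMap (Polynomial (Polynomial ℂ)) Ffield (Polynomial.C Polynomial.X)

/-- The rational function `z` (the second variable). -/
noncomputable def zz : Ffield :=
  algebraMap (Polynomial (Polynomial ℂ)) Ffield Polynomial.X

/-- `-z` is not a square in `ℂ(λ, z)`. -/
lemma aux_not_square (a b : Ffield) (h : zz * a ^ 2 + b ^ 2 = 0) : a = 0 ∧ b = 0 := by
  by_cases ha : a = 0
  · subst ha
    refine ⟨rfl, ?_⟩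
    simpa using h
  exfalso
  have h1 : zz = -(b / a) ^ 2 := by
    field_simp
    linear_combination h
  obtain ⟨p, q, hq, hpq⟩ := IsFractionRing.div_surjective
    (A := Polynomial (Polynomial ℂ)) (b / a)
  have hq0 : q ≠ 0 := nonZeroDivisors.ne_zero hq
  have hq1 : algebraMap (Polynomial (Polynomial ℂ)) Ffield q ≠ 0 := by
    simpa using hq0
  rw [← hpq, zz] at h1
  field_simp at h1
  have h2 : Polynomial.X * q ^ 2 = -p ^ 2 := by
    apply IsFractionRing.injective (Polynomial (Polynomial ℂ)) Ffield
    simp only [map_mul, map_pow, map_neg]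
    linear_combination h1
  have h3 := congrArg Polynomial.natDegree h2
  rw [Polynomial.natDegree_X_mul (pow_ne_zero 2 hq0), Polynomial.natDegree_neg,
    Polynomial.natDegree_pow, Polynomial.natDegree_pow] at h3
  omega

/-- The top coefficient of a square. -/
lemma aux_sq_coeff (f : LaurentPolynomial Ffield) (d : ℤ)
    (hf : ∀ n, d < n → f.coeff n = 0) : (f ^ 2).coeff (d + d) = f.coeff d ^ 2 := by
  rw [pow_two, pow_two]
  apply AddMonoidAlgebra.coeff_mul_add_of_uniqueAdd
  intro x y hx hy hxy
  have h1 : x ≤ d := by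
    by_contra hc
    exact (Finsupp.mem_support_iff.mp hx) (hf x (by omega))
  have h2 : y ≤ d := by
    by_contra hc
    exact (Finsupp.mem_support_iff.mp hy) (hf y (by omega))
  omega

/-- Solutions of the equation in Laurent polynomials have no positive powers. -/
lemma aux_top (y w : LaurentPolynomial Ffield) (c : Ffield)
    (h : zz • w ^ 2 + y ^ 2 + w + LaurentPolynomial.C c = 0) (n : ℤ) (hn : 0 < n) :
    y.coeff n = 0 ∧ w.coeff n = 0 := by
  classical
  by_contra hcon
  let S : Finset ℤ := y.coeff.support ∪ w.coeff.support
  have hmem : ∀ m, m ∈ S ↔ ¬ (y.coeff m = 0 ∧ w.coeff m = 0) := by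
    intro m
    simp only [S, Finset.mem_union, Finsupp.mem_support_iff]
    tauto
  have hnS : n ∈ S := (hmem n).2 hcon
  obtain ⟨d, hdS, hd⟩ := S.exists_max_image id ⟨n, hnS⟩
  have hnd : n ≤ d := hd n hnS
  have hz : ∀ m, d < m → y.coeff m = 0 ∧ w.coeff m = 0 := by
    intro m hm
    by_contra hc
    have : m ≤ d := hd m ((hmem m).2 hc)
    omega
  have h1 := congrArg (fun p : LaurentPolynomial Ffield => p.coeff (d + d)) h
  have h2 := aux_sq_coeff y d (fun m hm => (hz m hm).1)
  have h3 := aux_sq_coeff w d (fun m hm => (hz m hm).2)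
  have h4 : w.coeff (d + d) = 0 := (hz _ (by omega)).2
  have h5 : d + d ≠ 0 := by omega
  simp only [AddMonoidAlgebra.coeff_add, Finsupp.add_apply, AddMonoidAlgebra.coeff_smul,
    Finsupp.smul_apply, h2, h3, h4, LaurentPolynomial.C_apply, if_neg h5, smul_eq_mul,
    add_zero, AddMonoidAlgebra.coeff_zero, Finsupp.coe_zero, Pi.zero_apply] at h1
  obtain ⟨h6, h7⟩ := aux_not_square _ _ h1
  exact (hmem d).1 hdS ⟨h7, h6⟩

/-- Solutions of the equation in Laurent polynomials are constant. -/
lemma aux_const (y w : LaurentPolynomial Ffield) (c : Ffield)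
    (h : zz • w ^ 2 + y ^ 2 + w + LaurentPolynomial.C c = 0) :
    y = LaurentPolynomial.C (y.coeff 0) ∧ w = LaurentPolynomial.C (w.coeff 0) := by
  have hpos := aux_top y w c h
  have hi := congrArg (LaurentPolynomial.invert (R := Ffield)) h
  simp only [map_add, map_smul, map_pow, LaurentPolynomial.invert_C, map_zero] at hi
  have hneg := aux_top _ _ c hi
  simp only [LaurentPolynomial.invert_apply] at hneg
  have key : ∀ n, n ≠ 0 → y.coeff n = 0 ∧ w.coeff n = 0 := by
    intro n hn
    rcases lt_or_gt_of_ne hn with h0 | h0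
    · simpa using hneg (-n) (by omega)
    · exact hpos n h0
  constructor
  · refine LaurentPolynomial.ext fun n => ?_
    rw [LaurentPolynomial.C_apply]
    split_ifs with hn
    · rw [hn]
    · exact (key n hn).1
  · refine LaurentPolynomial.ext fun n => ?_
    rw [LaurentPolynomial.C_apply]
    split_ifs with hn
    · rw [hn]
    · exact (key n hn).2

/-- No surjective algebra map from the polynomial ring to Laurent polynomials kills the
equation. -/
lemma aux_no_surj (g : MvPolynomial (Fin 2) Ffield →ₐ[Ffield] LaurentPolynomial Ffield)
    (hg : g (C zz * X 1 ^ 2 + X 0 ^ 2 + X 1 + C (zz ^ 3) - C lam) = 0)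
    (hs : Function.Surjective g) : False := by
  have hC : ∀ a, g (C a) = LaurentPolynomial.C a := fun a => g.commutes a
  have h : zz • g (X 1) ^ 2 + g (X 0) ^ 2 + g (X 1) + LaurentPolynomial.C (zz ^ 3 - lam) = 0 := by
    rw [← hg, ← hC]
    simp only [map_add, map_sub, map_mul, map_pow, Algebra.smul_def, hC,
      LaurentPolynomial.C_eq_algebraMap]
    ring
  obtain ⟨h0, h1⟩ := aux_const _ _ _ h
  have hall : ∀ p, ∃ a, g p = LaurentPolynomial.C a := by
    intro p
    induction p using MvPolynomial.induction_on with
    | C a => exact ⟨a, hC a⟩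
    | add p q hp hq =>
      obtain ⟨a, ha⟩ := hp
      obtain ⟨b, hb⟩ := hq
      exact ⟨a + b, by rw [map_add, map_add, ha, hb]⟩
    | mul_X p i hp =>
      obtain ⟨a, ha⟩ := hp
      have hi : ∃ b, g (X i) = LaurentPolynomial.C b := by
        fin_cases i
        · exact ⟨_, h0⟩
        · exact ⟨_, h1⟩
      obtain ⟨b, hb⟩ := hi
      exact ⟨a * b, by rw [map_mul, map_mul, ha, hb]⟩
  obtain ⟨p, hp⟩ := hs (LaurentPolynomial.T 1)
  obtain ⟨a, ha⟩ := hall p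
  rw [hp] at ha
  have := congrArg (fun q : LaurentPolynomial Ffield => q.coeff 1) ha
  simp at this


/-- An isomorphism from a principal quotient lifts to a surjection killing the generator. -/
lemma aux_quot {K A B : Type*} [Field K] [CommRing A] [Algebra K A] [CommRing B] [Algebra K B]
    (p : A) (e : (A ⧸ Ideal.span ({p} : Set A)) ≃ₐ[K] B) :
    ∃ g : A →ₐ[K] B, g p = 0 ∧ Function.Surjective g := by
  refine ⟨e.toAlgHom.comp (Ideal.Quotient.mkₐ K _), ?_,
    e.surjective.comp (Ideal.Quotient.mkₐ_surjective K _)⟩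
  have h : Ideal.Quotient.mk (Ideal.span ({p} : Set A)) p = 0 :=
    Ideal.Quotient.eq_zero_iff_mem.2 (Ideal.subset_span rfl)
  exact (congrArg e h).trans (map_zero e)

/-- The generic fiber of `ξ₀ = (f, pr_z) : 𝔸³ → 𝔸²`, `f(y,z,w) = w²z + y² + w + z³`,
is a *nontrivial* form of the punctured affine line over `ℂ(λ, z)`: the coordinate
ring `B = F[Y,W]/(z·W² + Y² + W + z³ − λ)` is not `F`-isomorphic to the Laurent
polynomial ring `F[U, U⁻¹]` (here `Y = X 0`, `W = X 1`). -/
theorem generic_fiber_nontrivial_form_of_punctured_line :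
    IsEmpty ((MvPolynomial (Fin 2) Ffield ⧸
        Ideal.span ({C zz * X 1 ^ 2 + X 0 ^ 2 + X 1 + C (zz ^ 3) - C lam} :
          Set (MvPolynomial (Fin 2) Ffield)))
      ≃ₐ[Ffield] LaurentPolynomial Ffield) := by
  refine ⟨fun e => ?_⟩
  obtain ⟨g, hg, hs⟩ := aux_quot _ e
  exact aux_no_surj g hg hs
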